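/- Let T be a finite rooted binary tree with leaf assignment χ, let P(T) be any path decomposition of T, and let S ⊆ P(T) be a set of paths no two of which are in an ancestor–descendant relation in the shrub of P(T). Then every vertex v of T lies in H_p for at most two paths p ∈ S. -/

import Mathlib

open scoped Classical
noncomputable section

/-- A finite rooted binary tree on vertex set `V`: every non-root vertex has a parent,
the root has none, depths are consistent (ensuring acyclicity), and each vertex has
at most two children. -/
structure RBTree (V : Type) [Fintype V] [DecidableEq V] where
  parent : V → Option V
  root : V
  depth : V → ℕ
  parent_root : parent root = none
  root_of_parent_none : ∀ v, parent v = none → v = root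
  depth_parent : ∀ v u, parent v = some u → depth v = depth u + 1
  binary : ∀ v : V, (Finset.univ.filter (fun c => parent c = some v)).card ≤ 2

namespace RBTree

variable {V : Type} [Fintype V] [DecidableEq V]

/-- The children of a vertex. -/
def children (T : RBTree V) (v : V) : Finset V :=
  Finset.univ.filter (fun c => T.parent c = some v)

/-- A leaf is a vertex with no children. -/
def IsLeaf (T : RBTree V) (v : V) : Prop := T.children v = ∅

/-- Iterated parent map. -/
def parentIter (T : RBTree V) : ℕ → V → Option V
  | 0, v => some v
  | n + 1, v => (T.parentIter n v).bind T.parent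

/-- `u` is a (weak) ancestor of `v`: `u` lies on the path from `v` to the root
(including `v` itself). -/
def Anc (T : RBTree V) (u v : V) : Prop := ∃ n, T.parentIter n v = some u

/-- `u` is a strict ancestor of `v`. -/
def StrictAnc (T : RBTree V) (u v : V) : Prop := ∃ n, 0 < n ∧ T.parentIter n v = some u

/-- `L(T_v)`: the leaves of the subtree rooted at `v`. -/
def subtreeLeaves (T : RBTree V) (v : V) : Finset V :=
  Finset.univ.filter (fun l => T.IsLeaf l ∧ T.Anc v l)

/-- A leaf assignment `χ` assigns to each internal vertex a set of leaves containing
exactly one leaf from the subtree of each of its children (and nothing else);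
leaves are assigned the empty set. -/
structure LeafAssignment (T : RBTree V) where
  χ : V → Finset V
  mem_leaf : ∀ v l, l ∈ χ v → T.IsLeaf l
  mem_desc : ∀ v l, l ∈ χ v → ∃ c ∈ T.children v, T.Anc c l
  unique_child : ∀ v, ∀ c ∈ T.children v, ∃! l, l ∈ χ v ∧ T.Anc c l

/-- The heap `H_v = {u ∈ A(v) : χ(u) ∩ L(T_v) ≠ ∅}` of a vertex `v`. -/
def heap (T : RBTree V) (A : T.LeafAssignment) (v : V) : Finset V :=
  Finset.univ.filter (fun u => T.StrictAnc u v ∧ (A.χ u ∩ T.subtreeLeaves v).Nonempty)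

/-- A leaf path: the set of vertices on a monotone path from some leaf `ℓ` up to an
ancestor `b` of `ℓ`. -/
def IsLeafPath (T : RBTree V) (p : Finset V) : Prop :=
  ∃ ℓ b, T.IsLeaf ℓ ∧ T.Anc b ℓ ∧
    p = Finset.univ.filter (fun u => T.Anc u ℓ ∧ T.Anc b u)

/-- The base `b(p)` of a path: its vertex closest to the root. -/
def base (T : RBTree V) (p : Finset V) : V :=
  if h : ∃ b, b ∈ p ∧ ∀ w ∈ p, T.Anc b w then h.choose else T.root

/-- The leaf `ℓ(p)` of a path. -/
def pathLeaf (T : RBTree V) (p : Finset V) : V :=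
  if h : ∃ l, l ∈ p ∧ ∀ w ∈ p, T.Anc w l then h.choose else T.root

/-- `H_p = H_{b(p)}`. -/
def pathHeap (T : RBTree V) (A : T.LeafAssignment) (p : Finset V) : Finset V :=
  T.heap A (T.base p)

/-- A path decomposition: a partition of the vertex set into leaf paths. -/
def IsPathDecomp (T : RBTree V) (P : Finset (Finset V)) : Prop :=
  (∀ p ∈ P, T.IsLeafPath p) ∧ (∀ v : V, ∃! p, p ∈ P ∧ v ∈ p)

/-- `q` is a child of `p` in the shrub: the parent of `b(q)` lies on `p`. -/
def ShrubParent (T : RBTree V) (p q : Finset V) : Prop :=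
  ∃ u, T.parent (T.base q) = some u ∧ u ∈ p

/-- `p` is a strict ancestor of `q` in the shrub: some vertex of `p` is a strict
ancestor of `b(q)` in `T` (and `p ≠ q`). -/
def ShrubStrictAnc (T : RBTree V) (p q : Finset V) : Prop :=
  p ≠ q ∧ ∃ u ∈ p, T.StrictAnc u (T.base q)

/-- Weak ancestor relation in the shrub. -/
def ShrubAnc (T : RBTree V) (p q : Finset V) : Prop :=
  p = q ∨ T.ShrubStrictAnc p q

/-- A maximum path decomposition w.r.t. a leaf assignment: a path decomposition in
which each internal vertex lies on the same path as a child of maximal heap size. -/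
def IsMaxPathDecomp (T : RBTree V) (A : T.LeafAssignment) (P : Finset (Finset V)) : Prop :=
  T.IsPathDecomp P ∧
    ∀ p ∈ P, ∀ v ∈ p, ∀ c ∈ T.children v, c ∈ p →
      ∀ c' ∈ T.children v, (T.heap A c').card ≤ (T.heap A c).card

/-- A path `p` is short if `|p| < sqrt(|H_p|)/100`. -/
def IsShort (T : RBTree V) (A : T.LeafAssignment) (p : Finset V) : Prop :=
  (p.card : ℝ) < Real.sqrt ((T.pathHeap A p).card) / 100

/-- The tall support chain of a path `p`: the maximal chain of tall paths in the shrub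
starting at the parent of `p` and going up. -/
def TallChain (T : RBTree V) (A : T.LeafAssignment) (P : Finset (Finset V)) (p : Finset V) :
    Finset (Finset V) :=
  P.filter (fun q => T.ShrubStrictAnc q p ∧
    ∀ r ∈ P, T.ShrubStrictAnc r p → T.ShrubAnc q r → ¬ T.IsShort A r)

/-- A short path is supported if at least `|H_p|/100` of the vertices of `H_p` lie on
paths of its tall support chain. -/
def IsSupported (T : RBTree V) (A : T.LeafAssignment) (P : Finset (Finset V))
    (p : Finset V) : Prop :=
  ((T.pathHeap A p).card : ℝ) / 100 ≤
    (((T.pathHeap A p).filter (fun v => ∃ q ∈ T.TallChain A P p, v ∈ q)).card : ℝ)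

/-- The reduced heap `H̃_p`: vertices of `H_p` not lying on the tall support chain. -/
def redHeap (T : RBTree V) (A : T.LeafAssignment) (P : Finset (Finset V))
    (p : Finset V) : Finset V :=
  (T.pathHeap A p).filter (fun v => ∀ q ∈ T.TallChain A P p, v ∉ q)

/-- `q` is the parent of the unsupported short path `p` in the shrub forest of
unsupported short paths: `q` is the first short path on the chain of strict shrub
ancestors of `p`. -/
def ForestParent (T : RBTree V) (A : T.LeafAssignment) (P : Finset (Finset V))
    (q p : Finset V) : Prop :=
  q ∈ P ∧ p ∈ P ∧ T.IsShort A q ∧ T.IsShort A p ∧ ¬ T.IsSupported A P p ∧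
    T.ShrubStrictAnc q p ∧
    ∀ r ∈ P, T.ShrubStrictAnc r p → T.ShrubStrictAnc q r → ¬ T.IsShort A r

/-- `U` is the connected component of the shrub forest of unsupported short paths
rooted at the supported short path `r`. -/
def IsComponent (T : RBTree V) (A : T.LeafAssignment) (P : Finset (Finset V))
    (U : Finset (Finset V)) (r : Finset V) : Prop :=
  U ⊆ P ∧ r ∈ U ∧ T.IsShort A r ∧ T.IsSupported A P r ∧
    (∀ p ∈ U, T.IsShort A p) ∧
    (∀ p ∈ U, p ≠ r → ¬ T.IsSupported A P p) ∧
    (∀ p ∈ U, p ≠ r → ∃ q ∈ U, T.ForestParent A P q p) ∧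
    (∀ q ∈ U, ∀ p ∈ P, T.ForestParent A P q p → p ∈ U)

/-- `q` lies in the subtree of the shrub forest rooted at `p`. -/
def ForestDesc (T : RBTree V) (A : T.LeafAssignment) (P : Finset (Finset V))
    (p q : Finset V) : Prop :=
  Relation.ReflTransGen (fun a b => T.ForestParent A P a b) p q

/-- `U_p`: the nodes of `U` in the subtree of the shrub forest rooted at `p`. -/
def usub (T : RBTree V) (A : T.LeafAssignment) (P : Finset (Finset V))
    (U : Finset (Finset V)) (p : Finset V) : Finset (Finset V) :=
  U.filter (fun q => T.ForestDesc A P p q)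

/-- The children of `p` in the shrub forest (within `U`). -/
def forestChildren (T : RBTree V) (A : T.LeafAssignment) (P : Finset (Finset V))
    (U : Finset (Finset V)) (p : Finset V) : Finset (Finset V) :=
  U.filter (fun q => T.ForestParent A P p q)

/-- The residue `R_p = |H̃_p| − Σ_{q child of p} |H̃_q|`. -/
def residue (T : RBTree V) (A : T.LeafAssignment) (P : Finset (Finset V))
    (U : Finset (Finset V)) (p : Finset V) : ℤ :=
  ((T.redHeap A P p).card : ℤ) -
    ∑ q ∈ T.forestChildren A P U p, ((T.redHeap A P q).card : ℤ)

/-- `R⁺_p = max(R_p, 0)`. -/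
def resPlus (T : RBTree V) (A : T.LeafAssignment) (P : Finset (Finset V))
    (U : Finset (Finset V)) (p : Finset V) : ℤ :=
  max (T.residue A P U p) 0

/-- The weight `W_p = Σ_{q ∈ U_p} R⁺_q`. -/
def weight (T : RBTree V) (A : T.LeafAssignment) (P : Finset (Finset V))
    (U : Finset (Finset V)) (p : Finset V) : ℤ :=
  ∑ q ∈ T.usub A P U p, T.resPlus A P U q

end RBTree

namespace RBTree

variable {V : Type} [Fintype V] [DecidableEq V]

theorem parentIter_add (T : RBTree V) (m n : ℕ) (v : V) :
    T.parentIter (n + m) v = (T.parentIter n v).bind (T.parentIter m) := by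
  induction m with
  | zero => cases T.parentIter n v <;> simp [parentIter]
  | succ m ih =>
    rw [← add_assoc, parentIter, ih]
    cases T.parentIter n v <;> simp [parentIter]

/-- Two ancestors of the same vertex are equal or one is a strict ancestor of the other. -/
theorem Anc.eq_or_strictAnc {T : RBTree V} {a b l : V} (ha : T.Anc a l) (hb : T.Anc b l) :
    a = b ∨ T.StrictAnc a b ∨ T.StrictAnc b a := by
  obtain ⟨n, hn⟩ := ha
  obtain ⟨m, hm⟩ := hb
  rcases lt_trichotomy n m with h | rfl | h
  · obtain ⟨k, rfl⟩ := Nat.exists_eq_add_of_le h.le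
    rw [parentIter_add, hn] at hm
    exact Or.inr (Or.inr ⟨k, by lia, by simpa using hm⟩)
  · exact Or.inl (Option.some.inj (hn.symm.trans hm))
  · obtain ⟨k, rfl⟩ := Nat.exists_eq_add_of_le h.le
    rw [parentIter_add, hm] at hn
    exact Or.inr (Or.inl ⟨k, by lia, by simpa using hn⟩)

theorem IsLeafPath.base_mem {T : RBTree V} {p : Finset V} (hp : T.IsLeafPath p) :
    T.base p ∈ p := by
  have h : ∃ b, b ∈ p ∧ ∀ w ∈ p, T.Anc b w := by
    obtain ⟨l, b, -, hbl, rfl⟩ := hp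
    exact ⟨b, by simpa using ⟨hbl, 0, rfl⟩, fun w hw => (Finset.mem_filter.mp hw).2.2⟩
  rw [base, dif_pos h]
  exact h.choose_spec.1

theorem LeafAssignment.card_χ_le_two {T : RBTree V} (A : T.LeafAssignment) (v : V) :
    (A.χ v).card ≤ 2 := by
  choose! c hc hcl using A.mem_desc v
  refine (Finset.card_le_card_of_injOn c hc fun l hl m hm hlm => ?_).trans
    (T.binary v)
  exact (A.unique_child v (c l) (hc l hl)).unique ⟨hl, hcl l hl⟩ ⟨hm, hlm ▸ hcl m hm⟩

/-- Paths of a decomposition whose bases have a common descendant are comparable in the shrub. -/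
theorem IsPathDecomp.eq_or_shrubStrictAnc {T : RBTree V} {P : Finset (Finset V)}
    (hP : T.IsPathDecomp P) {p q : Finset V} (hp : p ∈ P) (hq : q ∈ P) {l : V}
    (hpl : T.Anc (T.base p) l) (hql : T.Anc (T.base q) l) :
    p = q ∨ T.ShrubStrictAnc p q ∨ T.ShrubStrictAnc q p := by
  by_cases hpq : p = q
  · exact Or.inl hpq
  have hbp := (hP.1 p hp).base_mem
  have hbq := (hP.1 q hq).base_mem
  rcases hpl.eq_or_strictAnc hql with h | h | h
  · exact Or.inl ((hP.2 (T.base p)).unique ⟨hp, hbp⟩ ⟨hq, h ▸ hbq⟩)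
  · exact Or.inr (Or.inl ⟨hpq, _, hbp, h⟩)
  · exact Or.inr (Or.inr ⟨Ne.symm hpq, _, hbq, h⟩)

end RBTree

open RBTree in
/-- if `S` is a set of paths of a path decomposition, no two of which are in
an ancestor–descendant relation in the shrub, then every vertex `v` lies in `H_p` for at
most two paths `p ∈ S`. -/
theorem antichain_heap_mem_le_two {V : Type} [Fintype V] [DecidableEq V]
    (T : RBTree V) (A : T.LeafAssignment) (P : Finset (Finset V))
    (hP : T.IsPathDecomp P) (S : Finset (Finset V)) (hS : S ⊆ P)
    (hanti : ∀ p ∈ S, ∀ q ∈ S, ¬ T.ShrubStrictAnc p q) (v : V) :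
    (S.filter (fun p => v ∈ T.pathHeap A p)).card ≤ 2 := by
  have hleaf : ∀ p ∈ S.filter (fun p => v ∈ T.pathHeap A p),
      ∃ l, l ∈ A.χ v ∧ T.Anc (T.base p) l := by
    intro p hp
    obtain ⟨l, hl⟩ := (Finset.mem_filter.mp (Finset.mem_filter.mp hp).2).2.2
    rw [Finset.mem_inter] at hl
    exact ⟨l, hl.1, (Finset.mem_filter.mp hl.2).2.2⟩
  have : Nonempty V := ⟨v⟩
  choose! f hf hfa using hleaf
  refine (Finset.card_le_card_of_injOn f hf fun p hp q hq hpq => ?_).trans (A.card_χ_le_two v)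
  have hpS := (Finset.mem_filter.mp hp).1
  have hqS := (Finset.mem_filter.mp hq).1
  rcases hP.eq_or_shrubStrictAnc (hS hpS) (hS hqS) (hfa p hp) (hpq ▸ hfa q hq) with h | h | h
  · exact h
  · exact absurd h (hanti p hpS q hqS)
  · exact absurd h (hanti q hqS p hpS)
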